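/- Let Σ be a positive definite real matrix indexed by a finite set V with K = Σ⁻¹, and suppose K implies the graph G = (V, E). Then for every pair of distinct vertices x, y ∈ V and every Q ⊆ V \ {x, y}, the limited-order networked partial covariance ω_{xy·Q} = ω(⟨x, y⟩, Σ_{(Q∪{x,y})(Q∪{x,y})}) satisfies ω_{xy·Q} = Σ_{π ∈ Π_xy, V(π) ⊆ V\Q} ω(π, Σ) · (1 − ρ²_{(P\{x,y}):Q|{x,y}}), where for each path π, P = V(π), and the sum runs over all paths between x and y in G whose vertex sets avoid Q. (Limited-order networked partial covariance decomposition, Theorem 3.) -/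

import Mathlib

open Matrix BigOperators

variable {V : Type*} [Fintype V] [DecidableEq V]

/-- Submatrix of `M` with rows indexed by `A` and columns indexed by `B`. -/
def subm (M : Matrix V V ℝ) (A B : Finset V) : Matrix A B ℝ :=
  M.submatrix (fun i => (i : V)) (fun j => (j : V))

/-- Partial covariance matrix `Σ_{AA·B} = Σ_AA − Σ_AB (Σ_BB)⁻¹ Σ_BA`. -/
noncomputable def pcov (M : Matrix V V ℝ) (A B : Finset V) : Matrix A A ℝ :=
  subm M A A - subm M A B * (subm M B B)⁻¹ * subm M B A

/-- A matrix `K` indexed by `W` implies a graph `G` on `W` if every nonzero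
off-diagonal entry of `K` corresponds to an edge of `G`. -/
def MatImplies {W : Type*} (K : Matrix W W ℝ) (G : SimpleGraph W) : Prop :=
  ∀ u v : W, u ≠ v → K u v ≠ 0 → G.Adj u v

/-- Path weight `ω(π, Γ) = (−1)^{|P|+1} det(Γ_PP) ∏_{{u,v} ∈ E(π)} (Γ⁻¹)_uv`. -/
noncomputable def pathWeight {G : SimpleGraph V} {x y : V} (M : Matrix V V ℝ) (p : G.Walk x y) : ℝ :=
  (-1 : ℝ) ^ (p.support.toFinset.card + 1)
    * (subm M p.support.toFinset p.support.toFinset).det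
    * (p.darts.map (fun d => M⁻¹ d.toProd.1 d.toProd.2)).prod

/-- Vector alienation coefficient `λ_{A:B}`. -/
noncomputable def alien (M : Matrix V V ℝ) (A B : Finset V) : ℝ :=
  (subm M (A ∪ B) (A ∪ B)).det / ((subm M A A).det * (subm M B B).det)

/-- Squared vector correlation `ρ²_{A:B} = 1 − λ_{A:B}`. -/
noncomputable def rho2 (M : Matrix V V ℝ) (A B : Finset V) : ℝ :=
  1 - alien M A B

/-- Partial vector alienation coefficient `λ_{A:B|C}`. -/
noncomputable def alienCond (M : Matrix V V ℝ) (A B C : Finset V) : ℝ :=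
  (pcov M (A ∪ B) C).det / ((pcov M A C).det * (pcov M B C).det)

/-- Squared partial vector correlation `ρ²_{A:B|C}`, with the convention that it
is `0` whenever `A = ∅` or `B = ∅`. -/
noncomputable def rho2Cond (M : Matrix V V ℝ) (A B C : Finset V) : ℝ :=
  if A = ∅ ∨ B = ∅ then 0 else 1 - alienCond M A B C

/-- The limited-order networked partial covariance
`ω_{xy·Q} = ω(⟨x,y⟩, Σ_{(Q∪{x,y})(Q∪{x,y})})
          = (−1) · det(Σ_{{x,y}{x,y}}) · ((Σ_{(Q∪{x,y})(Q∪{x,y})})⁻¹)_{xy}`. -/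
noncomputable def npcov (M : Matrix V V ℝ) (Q : Finset V) (x y : V) : ℝ :=
  (-1 : ℝ) * (subm M {x, y} {x, y}).det *
    (subm M (Q ∪ {x, y}) (Q ∪ {x, y}))⁻¹ ⟨x, by simp⟩ ⟨y, by simp⟩


theorem det_subm_congr (S : Matrix V V ℝ) {A B : Finset V} (h : A = B) :
    (subm S A A).det = (subm S B B).det := by
  subst h
  rfl

theorem subm_posDef {S : Matrix V V ℝ} (hS : S.PosDef) (A : Finset V) : (subm S A A).PosDef :=
  hS.submatrix Subtype.val_injective

theorem subm_det_pos {S : Matrix V V ℝ} (hS : S.PosDef) (A : Finset V) :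
    0 < (subm S A A).det := (subm_posDef hS A).det_pos

theorem subm_union (S : Matrix V V ℝ) (A B : Finset V) (h : Disjoint A B) :
    (subm S (A ∪ B) (A ∪ B)).submatrix (Equiv.Finset.union A B h) (Equiv.Finset.union A B h)
      = fromBlocks (subm S A A) (subm S A B) (subm S B A) (subm S B B) := by
  ext i j
  rcases i with i | i <;> rcases j with j | j <;> rfl

theorem det_subm_union {S : Matrix V V ℝ} (hS : S.PosDef) (A B : Finset V) (h : Disjoint A B) :
    (subm S (A ∪ B) (A ∪ B)).det = (subm S B B).det * (pcov S A B).det := by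
  rw [← det_submatrix_equiv_self (Equiv.Finset.union A B h), subm_union]
  have : Invertible (subm S B B) :=
    ((Matrix.isUnit_iff_isUnit_det _).2 (subm_det_pos hS B).ne'.isUnit).invertible
  rw [det_fromBlocks₂₂, pcov, invOf_eq_nonsing_inv]

theorem inv_subm_union {S : Matrix V V ℝ} (hS : S.PosDef) (A B : Finset V) (h : Disjoint A B)
    (i j : A) :
    (subm S (A ∪ B) (A ∪ B))⁻¹ ⟨i, Finset.mem_union_left _ i.2⟩ ⟨j, Finset.mem_union_left _ j.2⟩
      = (pcov S A B)⁻¹ i j := by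
  have hd := det_subm_union hS A B h
  have h0 : (pcov S A B).det ≠ 0 := by
    intro h1
    rw [h1, mul_zero] at hd
    exact (subm_det_pos hS _).ne' hd
  have i1 : Invertible (subm S B B) :=
    ((Matrix.isUnit_iff_isUnit_det _).2 (subm_det_pos hS B).ne'.isUnit).invertible
  have i2 : Invertible (subm S A A - subm S A B * ⅟ (subm S B B) * subm S B A) := by
    rw [invOf_eq_nonsing_inv]
    exact ((Matrix.isUnit_iff_isUnit_det _).2 h0.isUnit).invertible
  have i3 := fromBlocks₂₂Invertible (subm S A A) (subm S A B) (subm S B A) (subm S B B)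
  have key := inv_submatrix_equiv (subm S (A ∪ B) (A ∪ B)) (Equiv.Finset.union A B h)
    (Equiv.Finset.union A B h)
  rw [subm_union, ← invOf_eq_nonsing_inv, invOf_fromBlocks₂₂_eq] at key
  have k2 := congrFun (congrFun key (Sum.inl i)) (Sum.inl j)
  simp only [fromBlocks_apply₁₁, submatrix_apply, Equiv.Finset.union_inl] at k2
  rw [← k2, invOf_eq_nonsing_inv, invOf_eq_nonsing_inv, pcov]

/-- Entry of the conditional covariance given `C`. -/
noncomputable def sc (S : Matrix V V ℝ) (C : Finset V) (x z : V) : ℝ :=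
  S x z - (fun i : C => S x i) ⬝ᵥ ((subm S C C)⁻¹ *ᵥ (fun i : C => S i z))

theorem pcov_apply (S : Matrix V V ℝ) (A C : Finset V) (i j : A) :
    pcov S A C i j = sc S C i j := by
  rw [pcov, sc, Matrix.mul_assoc]
  rfl

theorem two_inv {n : Type*} [Fintype n] [DecidableEq n] (e : Fin 2 ≃ n) (N : Matrix n n ℝ)
    (h : N.det ≠ 0) : N.det * N⁻¹ (e 0) (e 1) = - N (e 0) (e 1) := by
  have h1 := inv_submatrix_equiv N e e
  have h2 := congrFun (congrFun h1 0) 1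
  rw [submatrix_apply] at h2
  rw [← h2, Matrix.inv_def, det_submatrix_equiv_self, Matrix.adjugate_fin_two]
  simp [h]

theorem npcov_eq {S : Matrix V V ℝ} (hS : S.PosDef) (Q : Finset V) (x y : V) (hxy : x ≠ y)
    (hQ : Disjoint {x, y} Q) :
    npcov S Q x y * (subm S (Q ∪ {x, y}) (Q ∪ {x, y})).det
      = (subm S {x, y} {x, y}).det * ((subm S Q Q).det * sc S Q x y) := by
  have hd := det_subm_union hS {x, y} Q hQ
  have h0 : (pcov S {x, y} Q).det ≠ 0 := by
    intro h1
    rw [h1, mul_zero] at hd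
    exact (subm_det_pos hS _).ne' hd
  have hi := inv_subm_union hS {x, y} Q hQ ⟨x, by simp⟩ ⟨y, by simp⟩
  let f : Fin 2 → ({x, y} : Finset V) := ![⟨x, by simp⟩, ⟨y, by simp⟩]
  have hf : Function.Bijective f := by
    constructor
    · intro i j hij
      fin_cases i <;> fin_cases j <;> simp_all [f, Subtype.ext_iff]
    · rintro ⟨z, hz⟩
      rcases Finset.mem_insert.1 hz with rfl | hz'
      · exact ⟨0, rfl⟩
      · exact ⟨1, by simp [f, (Finset.mem_singleton.1 hz').symm]⟩
  have ht := two_inv (Equiv.ofBijective f hf) _ h0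
  have e0 : Equiv.ofBijective f hf 0 = ⟨x, by simp⟩ := rfl
  have e1 : Equiv.ofBijective f hf 1 = ⟨y, by simp⟩ := rfl
  rw [e0, e1, pcov_apply] at ht
  simp only at ht
  have hW : ∀ (W : Finset V) (hW : W = {x, y} ∪ Q) (a : x ∈ W) (b : y ∈ W),
      (subm S W W)⁻¹ ⟨x, a⟩ ⟨y, b⟩ = (pcov S {x, y} Q)⁻¹ ⟨x, by simp⟩ ⟨y, by simp⟩ ∧
      (subm S W W).det = (subm S Q Q).det * (pcov S {x, y} Q).det := by
    rintro W rfl a b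
    exact ⟨hi, hd⟩
  obtain ⟨w1, w2⟩ := hW (Q ∪ {x, y}) (Finset.union_comm _ _) (by simp) (by simp)
  rw [npcov, w1, w2]
  linear_combination (-(subm S {x, y} {x, y}).det * (subm S Q Q).det) * ht

theorem cramer_sc {S : Matrix V V ℝ} (hS : S.PosDef) (C : Finset V) (x z : V) (hx : x ∉ C) :
    (subm S (C ∪ {x}) (C ∪ {x})).det *
      ((subm S (C ∪ {x}) (C ∪ {x}))⁻¹ *ᵥ (fun i => S i z)) ⟨x, by simp⟩
      = (subm S C C).det * sc S C x z := by
  have hdis : Disjoint C {x} := by simpa using hx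
  have h1 := det_smul_inv_mulVec_eq_cramer (subm S (C ∪ {x}) (C ∪ {x})) (fun i => S i z)
    (subm_det_pos hS _).ne'.isUnit
  have h2 := congrFun h1 ⟨x, by simp⟩
  rw [cramer_apply] at h2
  rw [Pi.smul_apply, smul_eq_mul] at h2
  rw [h2, ← det_submatrix_equiv_self (Equiv.Finset.union C {x} hdis)]
  have h3 : ((subm S (C ∪ {x}) (C ∪ {x})).updateCol ⟨x, by simp⟩ (fun i => S i z)).submatrix
      (Equiv.Finset.union C {x} hdis) (Equiv.Finset.union C {x} hdis)
      = fromBlocks (subm S C C) (Matrix.of fun i _ => S i z) (subm S {x} C)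
          (Matrix.of fun _ _ => S x z) := by
    ext i j
    rcases i with i | ⟨i, hi⟩ <;> rcases j with ⟨j, hj⟩ | ⟨j, hj⟩
    · have : j ≠ x := by rintro rfl; exact hx hj
      simp [Matrix.updateCol_apply, this, subm]
    · have : j = x := by simpa using hj
      simp [Matrix.updateCol_apply, this]
    · have : j ≠ x := by rintro rfl; exact hx hj
      simp [Matrix.updateCol_apply, this, subm]
    · have : j = x := by simpa using hj
      have : i = x := by simpa using hi
      simp [Matrix.updateCol_apply, *]
  rw [h3]
  have : Invertible (subm S C C) :=
    ((Matrix.isUnit_iff_isUnit_det _).2 (subm_det_pos hS C).ne'.isUnit).invertible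
  rw [det_fromBlocks₁₁, invOf_eq_nonsing_inv, det_unique (n := ({x} : Finset V)), Matrix.mul_assoc]
  rfl

theorem sc_self {S : Matrix V V ℝ} (hS : S.PosDef) (C : Finset V) (x : V) (hx : x ∉ C) :
    (subm S C C).det * sc S C x x = (subm S (C ∪ {x}) (C ∪ {x})).det := by
  have h := det_subm_union hS {x} C (by simpa using hx)
  rw [det_unique (n := ({x} : Finset V)), pcov_apply] at h
  rw [det_subm_congr S (Finset.union_comm C {x}), h]
  rfl

theorem sc_mem {S : Matrix V V ℝ} (hS : S.PosDef) (C : Finset V) (u z : V) (hu : u ∈ C) :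
    sc S C u z = 0 := by
  have h : subm S C C *ᵥ ((subm S C C)⁻¹ *ᵥ (fun i : C => S i z)) = (fun i : C => S i z) := by
    rw [mulVec_mulVec, mul_nonsing_inv _ (subm_det_pos hS _).ne'.isUnit, one_mulVec]
  have h2 := congrFun h ⟨u, hu⟩
  rw [sc, sub_eq_zero]
  exact h2.symm

theorem sum_K_sc {S : Matrix V V ℝ} (hS : S.PosDef) (D : Finset V) (x z : V) (hx : x ∈ D)
    (hxz : x ≠ z) :
    ∑ u, S⁻¹ x u * sc S D u z = - ((subm S D D)⁻¹ *ᵥ (fun i => S i z)) ⟨x, hx⟩ := by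
  have h1 : ∀ w, ∑ u, S⁻¹ x u * S u w = if x = w then 1 else 0 := by
    intro w
    have := congrFun (congrFun (nonsing_inv_mul S hS.det_pos.ne'.isUnit) x) w
    rw [mul_apply, one_apply] at this
    exact this
  simp only [sc, dotProduct, mul_sub, Finset.sum_sub_distrib, h1, if_neg hxz, Finset.mul_sum]
  rw [Finset.sum_comm]
  simp only [← mul_assoc, ← Finset.sum_mul, h1]
  rw [zero_sub, Finset.sum_eq_single ⟨x, hx⟩]
  · simp
  · rintro ⟨b, hb⟩ - hne
    rw [if_neg (by rintro rfl; exact hne rfl), zero_mul]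
  · simp

theorem sc_rec {S : Matrix V V ℝ} (hS : S.PosDef) (C : Finset V) (x z : V) (hx : x ∉ C)
    (hxz : x ≠ z) :
    (subm S C C).det * sc S C x z
      = ∑ u, -S⁻¹ x u * ((subm S (C ∪ {x}) (C ∪ {x})).det * sc S (C ∪ {x}) u z) := by
  rw [← cramer_sc hS C x z hx, ← neg_neg (mulVec _ _ _), ← sum_K_sc hS _ x z (by simp) hxz,
    ← Finset.sum_neg_distrib, Finset.mul_sum]
  exact Finset.sum_congr rfl fun u _ => by ring

theorem sc_paths {S : Matrix V V ℝ} (hS : S.PosDef) (G : SimpleGraph V) [DecidableRel G.Adj]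
    (hG : MatImplies S⁻¹ G) (y : V) (n : ℕ) :
    ∀ (C : Finset V) (x : V), Cᶜ.card = n → x ∉ C → y ∉ C →
    (subm S C C).det * sc S C x y =
      ∑ p ∈ Finset.univ.filter
            (fun p : G.Path x y => (p : G.Walk x y).support.toFinset ⊆ Cᶜ),
        (-1 : ℝ) ^ (p : G.Walk x y).length *
          (subm S (C ∪ (p : G.Walk x y).support.toFinset)
            (C ∪ (p : G.Walk x y).support.toFinset)).det *
          ((p : G.Walk x y).darts.map (fun d => S⁻¹ d.toProd.1 d.toProd.2)).prod := by
  induction n with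
  | zero =>
    intro C x h hx
    exact absurd (Finset.mem_compl.2 hx) (by simp [Finset.card_eq_zero.1 h])
  | succ n ih =>
    intro C x hn hx hy
    by_cases hxy : x = y
    · subst hxy
      rw [sc_self hS C x hx, Finset.sum_eq_single SimpleGraph.Path.nil]
      · change _ = (-1 : ℝ) ^ 0 * (subm S (C ∪ [x].toFinset) (C ∪ [x].toFinset)).det * 1
        rw [pow_zero, one_mul, mul_one]
        exact det_subm_congr S (by simp)
      · intro p _ hp
        exact absurd (SimpleGraph.Path.loop_eq p) hp
      · intro h
        exact absurd (by simpa [SimpleGraph.Path.nil] using hx) h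
    · rw [sc_rec hS C x y hx hxy]
      have hcard : (C ∪ {x})ᶜ.card = n := by
        have h1 : (C ∪ {x}).card = C.card + 1 :=
          Finset.card_union_of_disjoint (by simpa using hx)
        rw [Finset.card_compl] at hn ⊢
        omega
      have hy' : y ∉ C ∪ {x} := by simp [hy, Ne.symm hxy]
      have hsub : ∑ u, -S⁻¹ x u * ((subm S (C ∪ {x}) (C ∪ {x})).det * sc S (C ∪ {x}) u y)
          = ∑ u ∈ Finset.univ.filter (fun u => G.Adj x u ∧ u ∉ C),
            -S⁻¹ x u * ((subm S (C ∪ {x}) (C ∪ {x})).det * sc S (C ∪ {x}) u y) := by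
        symm
        apply Finset.sum_subset (Finset.subset_univ _)
        intro u _ hu
        by_cases hm : u ∈ C ∪ {x}
        · rw [sc_mem hS _ _ _ hm]; simp
        · have hm' : u ∉ C ∧ u ≠ x := by
            simp only [Finset.mem_union, Finset.mem_singleton, not_or] at hm
            exact hm
          have : ¬ G.Adj x u := fun ha => hu (by simp [ha, hm'.1])
          have hz : S⁻¹ x u = 0 := by
            by_contra h0
            exact this (hG x u hm'.2.symm h0)
          rw [hz]; simp
      rw [hsub, Finset.sum_congr rfl (fun u hu => by
        have hu' : G.Adj x u ∧ u ∉ C := by simpa using hu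
        rw [ih (C ∪ {x}) u hcard (by simp [hu'.2, hu'.1.ne']) hy', Finset.mul_sum]),
        Finset.sum_sigma']
      refine Finset.sum_bij (fun a ha => ⟨SimpleGraph.Walk.cons
        (show G.Adj x a.1 by simp at ha; exact ha.1.1) (a.2 : G.Walk a.1 y), ?_⟩) ?_ ?_ ?_ ?_
      · have ha2 := (Finset.mem_filter.1 (Finset.mem_sigma.1 ha).2).2
        refine a.2.2.cons fun hmem => ?_
        have := ha2 (List.mem_toFinset.2 hmem)
        simp at this
      · intro a ha
        have ha2 := (Finset.mem_filter.1 (Finset.mem_sigma.1 ha).2).2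
        refine Finset.mem_filter.2 ⟨Finset.mem_univ _, ?_⟩
        intro v hv
        simp only [SimpleGraph.Walk.support_cons, List.toFinset_cons, Finset.mem_insert] at hv
        rcases hv with rfl | hv
        · simpa using hx
        · have := ha2 hv
          simp only [Finset.mem_compl, Finset.mem_union, not_or] at this ⊢
          exact this.1
      · rintro ⟨u, p⟩ ha ⟨v, q⟩ hb hab
        simp only [Subtype.mk.injEq, SimpleGraph.Walk.cons.injEq] at hab
        obtain ⟨rfl, h⟩ := hab
        simp only [heq_eq_eq] at h
        rw [Subtype.ext h]
      · rintro ⟨p, hp⟩ hmem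
        cases p with
        | nil => exact absurd rfl hxy
        | @cons _ u _ hadj q =>
          have hq := (SimpleGraph.Walk.cons_isPath_iff _ _).1 hp
          have hs := (Finset.mem_filter.1 hmem).2
          refine ⟨⟨u, ⟨q, hq.1⟩⟩, ?_, rfl⟩
          have hs' : ∀ v ∈ q.support, v ∉ C := by
            intro v hv
            have : v ∈ Cᶜ := hs (by simp [hv])
            simpa using this
          refine Finset.mem_sigma.2 ⟨?_, ?_⟩
          · simp [hadj, hs' u q.start_mem_support]
          · refine Finset.mem_filter.2 ⟨Finset.mem_univ _, ?_⟩
            intro v hv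
            have hv' : v ∈ q.support := by simpa using hv
            have : v ≠ x := by rintro rfl; exact hq.2 hv'
            simp [hs' v hv', this]
      · rintro ⟨u, p⟩ ha
        have hadj : G.Adj x u := (Finset.mem_filter.1 (Finset.mem_sigma.1 ha).1).2.1
        have hset : C ∪ {x} ∪ (p : G.Walk u y).support.toFinset
            = C ∪ (SimpleGraph.Walk.cons hadj (p : G.Walk u y)).support.toFinset := by
          rw [Finset.union_assoc, SimpleGraph.Walk.support_cons, List.toFinset_cons]; rfl
        have hset := det_subm_congr S hset
        change _ = (-1 : ℝ) ^ (SimpleGraph.Walk.cons hadj (p : G.Walk u y)).length *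
          (subm S (C ∪ (SimpleGraph.Walk.cons hadj (p : G.Walk u y)).support.toFinset)
            (C ∪ (SimpleGraph.Walk.cons hadj (p : G.Walk u y)).support.toFinset)).det *
          ((SimpleGraph.Walk.cons hadj (p : G.Walk u y)).darts.map
            (fun d => S⁻¹ d.toProd.1 d.toProd.2)).prod
        rw [← hset, SimpleGraph.Walk.length_cons, SimpleGraph.Walk.darts_cons, List.map_cons,
          List.prod_cons]
        ring

theorem one_sub_rho {S : Matrix V V ℝ} (hS : S.PosDef) (Q T P : Finset V) (hTP : T ⊆ P)
    (hPQ : Disjoint P Q) :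
    (subm S P P).det * (1 - rho2Cond S (P \ T) Q T) * (subm S (Q ∪ T) (Q ∪ T)).det
      = (subm S T T).det * (subm S (Q ∪ P) (Q ∪ P)).det := by
  have hP : P \ T ∪ T = P := Finset.sdiff_union_of_subset hTP
  unfold rho2Cond
  split_ifs with h
  · rcases h with h | h
    · rw [h, Finset.empty_union] at hP
      subst hP
      ring
    · subst h
      rw [det_subm_congr S (Finset.empty_union T), det_subm_congr S (Finset.empty_union P)]
      ring
  · have hTQ : Disjoint T Q := hPQ.mono_left hTP
    have d1 := det_subm_union hS (P \ T) T Finset.sdiff_disjoint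
    have d2 := det_subm_union hS Q T hTQ.symm
    have d3 := det_subm_union hS (P \ T ∪ Q) T
      (Finset.disjoint_union_left.2 ⟨Finset.sdiff_disjoint, hTQ.symm⟩)
    have e3 : P \ T ∪ Q ∪ T = Q ∪ P := by
      rw [Finset.union_comm (P \ T) Q, Finset.union_assoc, hP]
    rw [hP] at d1
    rw [e3] at d3
    have p1 := subm_det_pos hS P
    have p2 := subm_det_pos hS (Q ∪ T)
    rw [d1] at p1
    rw [d2] at p2
    have n1 : (pcov S (P \ T) T).det ≠ 0 := fun h => by simp [h] at p1
    have n2 : (pcov S Q T).det ≠ 0 := fun h => by simp [h] at p2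
    rw [d1, d2, d3, alienCond]
    field_simp
    ring

/-- limited-order networked partial covariance decomposition (Theorem 3). -/
theorem limited_order_npcov_decomposition
    (S K : Matrix V V ℝ) (hS : S.PosDef) (hK : K = S⁻¹)
    (G : SimpleGraph V) [DecidableRel G.Adj] (hGK : MatImplies K G)
    (x y : V) (hxy : x ≠ y) (Q : Finset V) (hQ : Q ⊆ ({x, y} : Finset V)ᶜ) :
    npcov S Q x y
      = ∑ p ∈ Finset.univ.filter
            (fun p : G.Path x y => (p : G.Walk x y).support.toFinset ⊆ Qᶜ),
          pathWeight S (p : G.Walk x y)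
            * (1 - rho2Cond S ((p : G.Walk x y).support.toFinset \ {x, y}) Q {x, y}) := by
  subst hK
  have hdis : Disjoint ({x, y} : Finset V) Q := by
    rw [Finset.disjoint_left]
    intro a ha hq
    exact Finset.mem_compl.1 (hQ hq) ha
  have hW := subm_det_pos hS (Q ∪ {x, y})
  have hxQ : x ∉ Q := Finset.disjoint_left.1 hdis (by simp)
  have hyQ : y ∉ Q := Finset.disjoint_left.1 hdis (by simp)
  refine mul_right_cancel₀ hW.ne' ?_
  rw [npcov_eq hS Q x y hxy hdis, sc_paths hS G hGK y _ Q x rfl hxQ hyQ, Finset.mul_sum,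
    Finset.sum_mul]
  refine Finset.sum_congr rfl fun p hp => ?_
  have hpQ := (Finset.mem_filter.1 hp).2
  have hsub : ({x, y} : Finset V) ⊆ (p : G.Walk x y).support.toFinset := by
    intro a ha
    rcases Finset.mem_insert.1 ha with rfl | ha
    · simp
    · rw [Finset.mem_singleton.1 ha]; simp
  have hr := one_sub_rho hS Q {x, y} (p : G.Walk x y).support.toFinset hsub
    (by
      rw [Finset.disjoint_left]
      intro a ha
      exact Finset.mem_compl.1 (hpQ ha))
  have hc : (p : G.Walk x y).support.toFinset.card = (p : G.Walk x y).length + 1 := by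
    rw [List.toFinset_card_of_nodup p.2.support_nodup, SimpleGraph.Walk.length_support]
  rw [pathWeight, hc, pow_succ, pow_succ]
  linear_combination (-(-1 : ℝ) ^ (p : G.Walk x y).length *
    ((p : G.Walk x y).darts.map (fun d => S⁻¹ d.toProd.1 d.toProd.2)).prod) * hr
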